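/- arXiv:1910.11217 — 3 statements merged into one kernel-verified Lean document; each statement's English description precedes it below -/
import Mathlib

section
/- Let G_1,…,G_{n2} : ℝ^{N2} → ℝ^{N1} be differentiable, each L_G-smooth with B_G-bounded Jacobian, G = (1/n2) Σ_j G_j, and let F_1,…,F_{n1} : ℝ^{N1} → ℝ be differentiable, each L_F-smooth with B_F-bounded gradient. Fix x, x̃ ∈ ℝ^{N2} and integers A, B, C ≥ 1. For σ : {1,…,A} → {1,…,n2}, τ : {1,…,B} → {1,…,n2}, ρ : {1,…,C} → {1,…,n1}, let Ĝ(σ) = (1/A) Σ_t (G_{σ(t)}(x) − G_{σ(t)}(x̃)) + G(x̃), ∇Ĝ(τ) = (1/B) Σ_t (∇G_{τ(t)}(x) − ∇G_{τ(t)}(x̃)) + ∇G(x̃), and set D(σ,τ,ρ) = (1/C) Σ_{s=1}^{C} ([∇Ĝ(τ)]ᵀ ∇F_{ρ(s)}(Ĝ(σ)) − [∇G(x)]ᵀ ∇F_{ρ(s)}(G(x))). Then the average of ‖D(σ,τ,ρ)‖² over all triples (σ,τ,ρ) (uniform over all maps) is at most 2 (B_G⁴ L_F² / A + B_F² L_G²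 / B) ‖x̃ − x‖². -/
open Matrix

/-- The Frobenius norm of a real matrix. -/
noncomputable def frobNorm {k l : Type*} [Fintype k] [Fintype l] (M : Matrix k l ℝ) : ℝ :=
  Real.sqrt (∑ i, ∑ j, (M i j) ^ 2)

open Finset in
/-- Orthogonality of independent centred samples: the sum over all samples of size `A` of the
squared norm of the sample total. -/
theorem card_mul_sum_norm_sq_sum_of_sum_eq_zero {E : Type*} [NormedAddCommGroup E]
    [InnerProductSpace ℝ E] {n : ℕ} (w : Fin n → E) (hw : ∑ j, w j = 0) (A : ℕ) :
    (n : ℝ) * ∑ σ : Fin A → Fin n, ‖∑ t, w (σ t)‖ ^ 2 = A * (n : ℝ) ^ A * ∑ j, ‖w j‖ ^ 2 := by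
  induction A with
  | zero => simp
  | succ A ih =>
    have h : ∑ σ : Fin (A + 1) → Fin n, ‖∑ t, w (σ t)‖ ^ 2
        = ∑ p : Fin n × (Fin A → Fin n), ‖w p.1 + ∑ t, w (p.2 t)‖ ^ 2 := by
      refine (Fintype.sum_equiv (Fin.consEquiv fun _ => Fin n) _ _ fun p => ?_).symm
      simp [Fin.sum_univ_succ, Fin.consEquiv]
    have hcross : ∑ j, ∑ σ : Fin A → Fin n, 2 * inner ℝ (w j) (∑ t, w (σ t)) = 0 := by
      rw [sum_comm]
      refine sum_eq_zero fun σ _ => ?_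
      rw [← mul_sum, ← sum_inner, hw, inner_zero_left, mul_zero]
    have hsplit : ∑ σ : Fin (A + 1) → Fin n, ‖∑ t, w (σ t)‖ ^ 2
        = (n : ℝ) ^ A * ∑ j, ‖w j‖ ^ 2 + n * ∑ σ : Fin A → Fin n, ‖∑ t, w (σ t)‖ ^ 2 := by
      rw [h, Fintype.sum_prod_type]
      simp_rw [norm_add_sq_real, sum_add_distrib]
      rw [hcross]
      simp [mul_sum]
    rw [hsplit, ih]
    push_cast
    ring

/-- The deviation from the mean has at most the second moment of the family. -/
theorem sum_norm_sub_mean_sq_le {E : Type*} [NormedAddCommGroup E] [InnerProductSpace ℝ E]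
    {n : ℕ} (hn : 0 < n) (v : Fin n → E) :
    ∑ j, ‖v j - (n : ℝ)⁻¹ • ∑ i, v i‖ ^ 2 ≤ ∑ j, ‖v j‖ ^ 2 := by
  have hn' : (n : ℝ) ≠ 0 := by positivity
  set m := (n : ℝ)⁻¹ • ∑ i, v i with hm
  have hsum : ∑ i, v i = (n : ℝ) • m := by rw [hm, smul_inv_smul₀ hn']
  simp_rw [norm_sub_sq_real, Finset.sum_add_distrib, Finset.sum_sub_distrib]
  rw [← Finset.mul_sum, ← sum_inner, hsum, real_inner_smul_left, real_inner_self_eq_norm_sq]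
  simp only [Finset.sum_const, Finset.card_univ, Fintype.card_fin, nsmul_eq_mul]
  nlinarith [mul_nonneg (Nat.cast_nonneg (α := ℝ) n) (sq_nonneg ‖m‖)]

/-- Variance bound for the mean of `A` samples drawn uniformly with replacement. -/
theorem sum_norm_sample_mean_sub_mean_sq_le {E : Type*} [NormedAddCommGroup E]
    [InnerProductSpace ℝ E] {n A : ℕ} (hn : 0 < n) (hA : 0 < A) (v : Fin n → E) :
    ∑ σ : Fin A → Fin n, ‖(A : ℝ)⁻¹ • ∑ t, v (σ t) - (n : ℝ)⁻¹ • ∑ j, v j‖ ^ 2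
      ≤ (n : ℝ) ^ A * ((A : ℝ)⁻¹ * ((n : ℝ)⁻¹ * ∑ j, ‖v j‖ ^ 2)) := by
  have hn' : (0 : ℝ) < n := by positivity
  have hA' : (0 : ℝ) < A := by positivity
  set m := (n : ℝ)⁻¹ • ∑ i, v i with hm
  have hw : ∑ j, (v j - m) = 0 := by
    rw [Finset.sum_sub_distrib, Finset.sum_const, Finset.card_univ, Fintype.card_fin,
      ← Nat.cast_smul_eq_nsmul ℝ, hm, smul_inv_smul₀ hn'.ne', sub_self]
  have key := card_mul_sum_norm_sq_sum_of_sum_eq_zero (fun j => v j - m) hw A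
  have hterm : ∀ σ : Fin A → Fin n, ‖(A : ℝ)⁻¹ • ∑ t, v (σ t) - m‖ ^ 2
      = ((A : ℝ)⁻¹) ^ 2 * ‖∑ t, (v (σ t) - m)‖ ^ 2 := by
    intro σ
    have : (A : ℝ)⁻¹ • ∑ t, v (σ t) - m = (A : ℝ)⁻¹ • ∑ t, (v (σ t) - m) := by
      rw [Finset.sum_sub_distrib, Finset.sum_const, Finset.card_univ, Fintype.card_fin,
        ← Nat.cast_smul_eq_nsmul ℝ, smul_sub, inv_smul_smul₀ hA'.ne']
    rw [this, norm_smul, mul_pow, Real.norm_eq_abs, sq_abs]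
  simp_rw [hterm]
  rw [← Finset.mul_sum]
  calc ((A : ℝ)⁻¹) ^ 2 * ∑ σ : Fin A → Fin n, ‖∑ t, (v (σ t) - m)‖ ^ 2
      = ((A : ℝ)⁻¹) ^ 2 * ((n : ℝ)⁻¹ * (A * (n : ℝ) ^ A * ∑ j, ‖v j - m‖ ^ 2)) := by
        rw [← key, inv_mul_cancel_left₀ hn'.ne']
    _ = (n : ℝ) ^ A * ((A : ℝ)⁻¹ * ((n : ℝ)⁻¹ * ∑ j, ‖v j - m‖ ^ 2)) := by
        field_simp
    _ ≤ _ := by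
        gcongr ?_ * (?_ * (?_ * ?_))
        exact sum_norm_sub_mean_sq_le hn v

theorem frobNorm_nonneg {k l : Type*} [Fintype k] [Fintype l] (M : Matrix k l ℝ) :
    0 ≤ frobNorm M :=
  Real.sqrt_nonneg _

theorem frobNorm_sq {k l : Type*} [Fintype k] [Fintype l] (M : Matrix k l ℝ) :
    frobNorm M ^ 2 = ∑ i, ∑ j, (M i j) ^ 2 :=
  Real.sq_sqrt (by positivity)

theorem frobNorm_transpose {k l : Type*} [Fintype k] [Fintype l] (M : Matrix k l ℝ) :
    frobNorm Mᵀ = frobNorm M := by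
  simp only [frobNorm, Matrix.transpose_apply]
  rw [Finset.sum_comm]

/-- The Frobenius norm dominates the operator norm. -/
theorem norm_toEuclideanLin_le_frobNorm_mul {k l : Type*} [Fintype k] [Fintype l] [DecidableEq l]
    (M : Matrix k l ℝ) (v : EuclideanSpace ℝ l) :
    ‖Matrix.toEuclideanLin M v‖ ≤ frobNorm M * ‖v‖ := by
  refine (sq_le_sq₀ (norm_nonneg _) (mul_nonneg (frobNorm_nonneg M) (norm_nonneg v))).mp ?_
  rw [mul_pow, frobNorm_sq, EuclideanSpace.real_norm_sq_eq, EuclideanSpace.real_norm_sq_eq,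
    Finset.sum_mul]
  refine Finset.sum_le_sum fun i _ => ?_
  simpa [Matrix.toLpLin_apply, Matrix.mulVec, dotProduct] using
    Finset.sum_mul_sq_le_sq_mul_sq Finset.univ (fun j => M i j) fun j => v j

/-- Frobenius-norm version of the variance bound for the mean of samples of matrices. -/
theorem sum_frobNorm_sample_mean_sub_mean_sq_le {k l : Type*} [Fintype k] [Fintype l]
    {n A : ℕ} (hn : 0 < n) (hA : 0 < A) (v : Fin n → Matrix k l ℝ) :
    ∑ σ : Fin A → Fin n, frobNorm ((A : ℝ)⁻¹ • ∑ t, v (σ t) - (n : ℝ)⁻¹ • ∑ j, v j) ^ 2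
      ≤ (n : ℝ) ^ A * ((A : ℝ)⁻¹ * ((n : ℝ)⁻¹ * ∑ j, frobNorm (v j) ^ 2)) := by
  have hentry : ∀ i j, ∑ σ : Fin A → Fin n,
      ((A : ℝ)⁻¹ • ∑ t, v (σ t) - (n : ℝ)⁻¹ • ∑ s, v s : Matrix k l ℝ) i j ^ 2
        ≤ (n : ℝ) ^ A * ((A : ℝ)⁻¹ * ((n : ℝ)⁻¹ * ∑ s, v s i j ^ 2)) := by
    intro i j
    simpa [Matrix.sum_apply] using sum_norm_sample_mean_sub_mean_sq_le hn hA fun s => v s i j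
  have hswap : ∀ {ι : Type} [Fintype ι] (M : ι → Matrix k l ℝ),
      ∑ s, frobNorm (M s) ^ 2 = ∑ i, ∑ j, ∑ s, M s i j ^ 2 := by
    intro ι _ M
    simp_rw [frobNorm_sq]
    rw [Finset.sum_comm]
    exact Finset.sum_congr rfl fun i _ => Finset.sum_comm
  rw [hswap, hswap]
  refine (Finset.sum_le_sum fun i _ => Finset.sum_le_sum fun j _ => hentry i j).trans_eq ?_
  simp only [← Finset.mul_sum]

/-- A map whose Jacobian is bounded in Frobenius norm is Lipschitz. -/
theorem norm_sub_le_of_frobNorm_jacobian_le {k l : Type*} [Fintype k] [Fintype l] [DecidableEq l]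
    {g : EuclideanSpace ℝ l → EuclideanSpace ℝ k} {Dg : EuclideanSpace ℝ l → Matrix k l ℝ}
    {b : ℝ}
    (hg : ∀ x, HasFDerivAt g ((Matrix.toEuclideanLin (Dg x)).toContinuousLinearMap) x)
    (hb : ∀ x, frobNorm (Dg x) ≤ b) (x y : EuclideanSpace ℝ l) :
    ‖g x - g y‖ ≤ b * ‖x - y‖ := by
  refine convex_univ.norm_image_sub_le_of_norm_hasFDerivWithin_le
    (fun z _ => (hg z).hasFDerivWithinAt) (fun z _ => ?_) (Set.mem_univ y) (Set.mem_univ x)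
  refine ContinuousLinearMap.opNorm_le_bound _ ((frobNorm_nonneg _).trans (hb z)) fun v => ?_
  exact (norm_toEuclideanLin_le_frobNorm_mul _ v).trans (by gcongr; exact hb z)

theorem norm_inv_smul_sum_le {E : Type*} [NormedAddCommGroup E] [NormedSpace ℝ E] {n : ℕ}
    (hn : 0 < n) {v : Fin n → E} {b : ℝ} (hb : ∀ i, ‖v i‖ ≤ b) :
    ‖(n : ℝ)⁻¹ • ∑ i, v i‖ ≤ b := by
  have hn' : (0 : ℝ) < n := by positivity
  rw [norm_smul, norm_inv, Real.norm_natCast, inv_mul_le_iff₀ hn']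
  simpa using norm_sum_le_of_le Finset.univ fun i _ => hb i

theorem inv_mul_sum_le {n : ℕ} (hn : 0 < n) {f : Fin n → ℝ} {b : ℝ} (hb : ∀ i, f i ≤ b) :
    (n : ℝ)⁻¹ * ∑ i, f i ≤ b := by
  have hn' : (0 : ℝ) < n := by positivity
  rw [inv_mul_le_iff₀ hn']
  simpa using Finset.sum_le_sum fun i (_ : i ∈ Finset.univ) => hb i

/-- variance bound for the outer mini-batch deviation term `D(σ,τ,ρ)`. -/
theorem outer_minibatch_deviation_bound
    (N1 N2 n1 n2 : ℕ) (hn1 : 0 < n1) (hn2 : 0 < n2) (LG BG LF BF : ℝ)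
    (G : Fin n2 → EuclideanSpace ℝ (Fin N2) → EuclideanSpace ℝ (Fin N1))
    (DG : Fin n2 → EuclideanSpace ℝ (Fin N2) → Matrix (Fin N1) (Fin N2) ℝ)
    (hGd : ∀ j x, HasFDerivAt (G j) ((Matrix.toEuclideanLin (DG j x)).toContinuousLinearMap) x)
    (hGs : ∀ j x y, frobNorm (DG j x - DG j y) ≤ LG * ‖x - y‖)
    (hGb : ∀ j x, frobNorm (DG j x) ≤ BG)
    (F : Fin n1 → EuclideanSpace ℝ (Fin N1) → ℝ)
    (hFd : ∀ i, Differentiable ℝ (F i))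
    (hFs : ∀ i p q, ‖gradient (F i) p - gradient (F i) q‖ ≤ LF * ‖p - q‖)
    (hFb : ∀ i y, ‖gradient (F i) y‖ ≤ BF)
    (Gbar : EuclideanSpace ℝ (Fin N2) → EuclideanSpace ℝ (Fin N1))
    (hGbar : Gbar = fun x => (n2 : ℝ)⁻¹ • ∑ j, G j x)
    (DGbar : EuclideanSpace ℝ (Fin N2) → Matrix (Fin N1) (Fin N2) ℝ)
    (hDGbar : DGbar = fun x => (n2 : ℝ)⁻¹ • ∑ j, DG j x)
    (x xt : EuclideanSpace ℝ (Fin N2)) (A B C : ℕ) (hA : 1 ≤ A) (hB : 1 ≤ B) (hC : 1 ≤ C)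
    (Ghat : (Fin A → Fin n2) → EuclideanSpace ℝ (Fin N1))
    (hGhat : ∀ σ, Ghat σ = ((A : ℝ)⁻¹ • ∑ t, (G (σ t) x - G (σ t) xt)) + Gbar xt)
    (DGhat : (Fin B → Fin n2) → Matrix (Fin N1) (Fin N2) ℝ)
    (hDGhat : ∀ τ, DGhat τ = ((B : ℝ)⁻¹ • ∑ t, (DG (τ t) x - DG (τ t) xt)) + DGbar xt)
    (D : (Fin A → Fin n2) → (Fin B → Fin n2) → (Fin C → Fin n1) → EuclideanSpace ℝ (Fin N2))
    (hD : ∀ σ τ ρ, D σ τ ρ = (C : ℝ)⁻¹ • ∑ s,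
      (Matrix.toEuclideanLin (DGhat τ)ᵀ (gradient (F (ρ s)) (Ghat σ))
        - Matrix.toEuclideanLin (DGbar x)ᵀ (gradient (F (ρ s)) (Gbar x)))) :
    ((n2 : ℝ) ^ A)⁻¹ * ((n2 : ℝ) ^ B)⁻¹ * ((n1 : ℝ) ^ C)⁻¹ *
        ∑ σ : Fin A → Fin n2, ∑ τ : Fin B → Fin n2, ∑ ρ : Fin C → Fin n1, ‖D σ τ ρ‖ ^ 2
      ≤ 2 * (BG ^ 4 * LF ^ 2 / A + BF ^ 2 * LG ^ 2 / B) * ‖xt - x‖ ^ 2 := by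
  have hBG : 0 ≤ BG := (frobNorm_nonneg _).trans (hGb ⟨0, hn2⟩ x)
  have hBF : 0 ≤ BF := (norm_nonneg _).trans (hFb ⟨0, hn1⟩ 0)
  have hbar : ∀ v, ‖Matrix.toEuclideanLin (DGbar x)ᵀ v‖ ≤ BG * ‖v‖ := by
    intro v
    have h : Matrix.toEuclideanLin (DGbar x)ᵀ v
        = (n2 : ℝ)⁻¹ • ∑ j, Matrix.toEuclideanLin (DG j x)ᵀ v := by
      simp [hDGbar, Matrix.transpose_sum, LinearMap.sum_apply]
    rw [h]
    refine norm_inv_smul_sum_le hn2 fun j => (norm_toEuclideanLin_le_frobNorm_mul _ v).trans ?_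
    rw [frobNorm_transpose]
    gcongr
    exact hGb j x
  have hvalue : ∑ σ, ‖Ghat σ - Gbar x‖ ^ 2
      ≤ (n2 : ℝ) ^ A * ((A : ℝ)⁻¹ * (BG * ‖xt - x‖) ^ 2) := by
    have h : ∀ σ, Ghat σ - Gbar x = (A : ℝ)⁻¹ • ∑ t, (G (σ t) x - G (σ t) xt)
        - (n2 : ℝ)⁻¹ • ∑ j, (G j x - G j xt) := by
      intro σ
      rw [hGhat, hGbar, Finset.sum_sub_distrib (s := Finset.univ (α := Fin n2)), smul_sub]
      abel
    simp_rw [h]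
    refine (sum_norm_sample_mean_sub_mean_sq_le hn2 hA fun j => G j x - G j xt).trans ?_
    gcongr
    refine inv_mul_sum_le hn2 fun j => ?_
    rw [norm_sub_rev xt x]
    gcongr
    exact norm_sub_le_of_frobNorm_jacobian_le (hGd j) (hGb j) x xt
  have hjacobian : ∑ τ, frobNorm (DGhat τ - DGbar x) ^ 2
      ≤ (n2 : ℝ) ^ B * ((B : ℝ)⁻¹ * (LG * ‖xt - x‖) ^ 2) := by
    have h : ∀ τ, DGhat τ - DGbar x = (B : ℝ)⁻¹ • ∑ t, (DG (τ t) x - DG (τ t) xt)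
        - (n2 : ℝ)⁻¹ • ∑ j, (DG j x - DG j xt) := by
      intro τ
      rw [hDGhat, hDGbar, Finset.sum_sub_distrib (s := Finset.univ (α := Fin n2)), smul_sub]
      abel
    simp_rw [h]
    refine (sum_frobNorm_sample_mean_sub_mean_sq_le hn2 hB fun j => DG j x - DG j xt).trans ?_
    gcongr
    refine inv_mul_sum_le hn2 fun j => ?_
    rw [norm_sub_rev xt x]
    exact pow_le_pow_left₀ (frobNorm_nonneg _) (hGs j x xt) 2
  have hpoint : ∀ σ τ ρ, ‖D σ τ ρ‖ ^ 2 ≤ 2 * (BG ^ 2 * LF ^ 2 * ‖Ghat σ - Gbar x‖ ^ 2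
      + BF ^ 2 * frobNorm (DGhat τ - DGbar x) ^ 2) := by
    intro σ τ ρ
    have h : ‖D σ τ ρ‖ ≤ BG * (LF * ‖Ghat σ - Gbar x‖)
        + frobNorm (DGhat τ - DGbar x) * BF := by
      rw [hD]
      refine norm_inv_smul_sum_le hC fun s => ?_
      have hsplit : Matrix.toEuclideanLin (DGhat τ)ᵀ (gradient (F (ρ s)) (Ghat σ))
            - Matrix.toEuclideanLin (DGbar x)ᵀ (gradient (F (ρ s)) (Gbar x))
          = Matrix.toEuclideanLin (DGbar x)ᵀ
              (gradient (F (ρ s)) (Ghat σ) - gradient (F (ρ s)) (Gbar x))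
            + Matrix.toEuclideanLin (DGhat τ - DGbar x)ᵀ (gradient (F (ρ s)) (Ghat σ)) := by
        simp only [Matrix.transpose_sub, map_sub, LinearMap.sub_apply]
        abel
      rw [hsplit]
      refine (norm_add_le _ _).trans (add_le_add ((hbar _).trans ?_)
        ((norm_toEuclideanLin_le_frobNorm_mul _ _).trans ?_))
      · gcongr
        exact hFs _ _ _
      · rw [frobNorm_transpose]
        exact mul_le_mul_of_nonneg_left (hFb _ _) (frobNorm_nonneg _)
    refine (pow_le_pow_left₀ (norm_nonneg _) h 2).trans (add_sq_le.trans_eq ?_)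
    ring
  have hn1' : (0 : ℝ) < n1 := by positivity
  have hn2' : (0 : ℝ) < n2 := by positivity
  have hA' : (0 : ℝ) < A := by positivity
  have hB' : (0 : ℝ) < B := by positivity
  have htotal : ∑ σ : Fin A → Fin n2, ∑ τ : Fin B → Fin n2, ∑ ρ : Fin C → Fin n1, ‖D σ τ ρ‖ ^ 2
      ≤ (n1 : ℝ) ^ C * (2 * (BG ^ 2 * LF ^ 2 * ((n2 : ℝ) ^ B * ∑ σ, ‖Ghat σ - Gbar x‖ ^ 2)
        + BF ^ 2 * ((n2 : ℝ) ^ A * ∑ τ, frobNorm (DGhat τ - DGbar x) ^ 2))) := by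
    refine (Finset.sum_le_sum fun σ _ => Finset.sum_le_sum fun τ _ =>
      Finset.sum_le_sum fun ρ _ => hpoint σ τ ρ).trans_eq ?_
    simp only [Finset.sum_const, Finset.card_univ, Fintype.card_fun, Fintype.card_fin,
      nsmul_eq_mul, Nat.cast_pow, ← Finset.mul_sum, Finset.sum_add_distrib]
    ring
  rw [← mul_inv, ← mul_inv, inv_mul_le_iff₀ (by positivity)]
  calc _ ≤ _ := htotal
    _ ≤ (n1 : ℝ) ^ C * (2 * (BG ^ 2 * LF ^ 2 * ((n2 : ℝ) ^ B *
          ((n2 : ℝ) ^ A * ((A : ℝ)⁻¹ * (BG * ‖xt - x‖) ^ 2)))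
        + BF ^ 2 * ((n2 : ℝ) ^ A * ((n2 : ℝ) ^ B * ((B : ℝ)⁻¹ * (LG * ‖xt - x‖) ^ 2))))) := by
        gcongr
    _ = _ := by
        field_simp
end

section
/- Let L > 0, μ > 0, let f : ℝ^N → ℝ be differentiable and L-smooth, and let h : ℝ^N → ℝ be μ-strongly convex. Let α > 0, τ₁ ∈ (0, 1/(3αL)], τ₂ ∈ [0, 1 − τ₁]. Fix z_k, y_k, x̃ ∈ ℝ^N and set x_{k+1} = τ₁ z_k + τ₂ x̃ + (1 − τ₁ − τ₂) y_k. Let g̃ ∈ ℝ^N, and suppose z_{k+1} minimizes z ↦ ⟨g̃, z⟩ + (1/(2α))‖z − z_k‖² + h(z) over ℝ^N and y_{k+1} minimizes y ↦ ⟨g̃, y⟩ + (3L/2)‖y − x_{k+1}‖² + h(y) over ℝ^N. Set H = f + h. Then for every u ∈ ℝ^N and every β > 0: α⟨∇f(x_{k+1}), z_k − u⟩ − α h(u) ≤ (α/τ₁)(f(x_{k+1}) − H(y_{k+1})) + α(1/(4τ₁L) + β/2)‖g̃ − ∇f(x_{k+1})‖² + ((1 + α/β)/2)‖z_k − u‖²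 − ((1 + αμ)/2)‖z_{k+1} − u‖² + (ατ₂/τ₁) h(x̃) + (α(1 − τ₁ − τ₂)/τ₁) h(y_k). -/
open scoped RealInnerProductSpace

section

variable {E : Type*} [NormedAddCommGroup E] [InnerProductSpace ℝ E]

/-- The descent lemma: a function with `L`-Lipschitz gradient lies below its quadratic upper
model. -/
lemma le_add_inner_gradient_add_sq [CompleteSpace E] {f : E → ℝ} {L : ℝ}
    (hf : Differentiable ℝ f)
    (hL : ∀ x y, ‖gradient f x - gradient f y‖ ≤ L * ‖x - y‖) (x y : E) :
    f y ≤ f x + ⟪gradient f x, y - x⟫ + L / 2 * ‖y - x‖ ^ 2 := by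
  set d := y - x with hd
  have hpath (t : ℝ) :
      HasDerivAt (fun t : ℝ => f (x + t • d)) ⟪gradient f (x + t • d), d⟫ t := by
    have h1 : HasDerivAt (fun t : ℝ => x + t • d) d t := by
      simpa using ((hasDerivAt_id t).smul_const d).const_add x
    have h2 := (hf (x + t • d)).hasFDerivAt.comp_hasDerivAt t h1
    rwa [← inner_gradient_left] at h2
  have hmodel (t : ℝ) :
      HasDerivAt (fun t : ℝ => f x + t * ⟪gradient f x, d⟫ + L / 2 * ‖d‖ ^ 2 * t ^ 2)
        (⟪gradient f x, d⟫ + L * t * ‖d‖ ^ 2) t := by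
    have h := (((hasDerivAt_id t).mul_const ⟪gradient f x, d⟫).const_add (f x)).add
      ((hasDerivAt_pow 2 t).const_mul (L / 2 * ‖d‖ ^ 2))
    refine h.congr_deriv ?_
    norm_num
    ring
  have key := image_le_of_deriv_right_le_deriv_boundary (a := 0) (b := 1)
    (fun t _ => (hpath t).continuousAt.continuousWithinAt)
    (fun t _ => (hpath t).hasDerivWithinAt) (by simp)
    (fun t _ => (hmodel t).continuousAt.continuousWithinAt)
    (fun t _ => (hmodel t).hasDerivWithinAt)
    (fun t ht => by
      have h1 := real_inner_le_norm (gradient f (x + t • d) - gradient f x) d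
      have h2 := mul_le_mul_of_nonneg_right (hL (x + t • d) x) (norm_nonneg d)
      rw [add_sub_cancel_left, norm_smul, Real.norm_of_nonneg ht.1] at h2
      rw [inner_sub_left] at h1
      linarith)
    (Set.right_mem_Icc.2 zero_le_one)
  simpa [hd] using key

/-- A strongly convex function grows at least quadratically away from a minimizer. -/
lemma StrongConvexOn.add_sq_le_of_isMinOn {s : Set E} {m : ℝ} {f : E → ℝ} {x y : E}
    (hf : StrongConvexOn s m f) (hmin : IsMinOn f s x) (hx : x ∈ s) (hy : y ∈ s) :
    f x + m / 2 * ‖x - y‖ ^ 2 ≤ f y := by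
  have hlim : Filter.Tendsto (fun t : ℝ => f x + (1 - t) * (m / 2 * ‖x - y‖ ^ 2))
      (nhdsWithin 0 (Set.Ioi 0)) (nhds (f x + m / 2 * ‖x - y‖ ^ 2)) := by
    have hcont : Continuous (fun t : ℝ => f x + (1 - t) * (m / 2 * ‖x - y‖ ^ 2)) := by fun_prop
    simpa using (hcont.tendsto 0).mono_left nhdsWithin_le_nhds
  refine le_of_tendsto hlim ?_
  filter_upwards [Ioo_mem_nhdsGT (zero_lt_one' ℝ)] with t ht
  have h1t : 0 ≤ 1 - t := by linarith [ht.2]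
  have h1 := hf.2 hx hy h1t ht.1.le (by ring)
  have h2 := isMinOn_iff.1 hmin _ (hf.1 hx hy h1t ht.1.le (by ring))
  simp only [smul_eq_mul] at h1
  refine le_of_mul_le_mul_left ?_ ht.1
  linarith

/-- Adding a linear term and a proximal quadratic `c / 2 * ‖· - w‖ ^ 2` to an `m`-strongly convex
function makes it `(c + m)`-strongly convex. -/
lemma StrongConvexOn.inner_add_sq_add {s : Set E} {m : ℝ} {f : E → ℝ}
    (hf : StrongConvexOn s m f) (g w : E) (c : ℝ) :
    StrongConvexOn s (c + m) fun z => ⟪g, z⟫ + c / 2 * ‖z - w‖ ^ 2 + f z := by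
  rw [strongConvexOn_iff_convex] at hf ⊢
  refine (((innerₛₗ ℝ (g - c • w)).convexOn hf.1).add
    (hf.add_const (c / 2 * ‖w‖ ^ 2))).congr fun z _ => ?_
  simp only [Pi.add_apply, innerₛₗ_apply_apply, inner_sub_left, real_inner_smul_left,
    norm_sub_sq_real, real_inner_comm z w]
  ring

/-- Young's inequality for the inner product. -/
lemma inner_le_mul_sq_add_sq_div {c : ℝ} (hc : 0 < c) (x y : E) :
    ⟪x, y⟫ ≤ c / 2 * ‖x‖ ^ 2 + 1 / (2 * c) * ‖y‖ ^ 2 := by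
  have h1 := real_inner_le_norm x y
  have h2 : c / 2 * ‖x‖ ^ 2 + 1 / (2 * c) * ‖y‖ ^ 2 - ‖x‖ * ‖y‖
      = (c * ‖x‖ - ‖y‖) ^ 2 / (2 * c) := by
    field_simp
    ring
  have h3 : 0 ≤ (c * ‖x‖ - ‖y‖) ^ 2 / (2 * c) := by positivity
  linarith

end

/-- key per-iteration coupling inequality (Lemma `cp1`). -/
theorem linear_coupling_step_bound
    (N : ℕ) (L μ α τ₁ τ₂ : ℝ) (hL : 0 < L) (hμ : 0 < μ) (hα : 0 < α)
    (hτ₁ : 0 < τ₁) (hτ₁' : τ₁ ≤ 1 / (3 * α * L)) (hτ₂ : 0 ≤ τ₂) (hτ₂' : τ₂ ≤ 1 - τ₁)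
    (f h : EuclideanSpace ℝ (Fin N) → ℝ)
    (hf : Differentiable ℝ f)
    (hsmooth : ∀ x y : EuclideanSpace ℝ (Fin N),
      ‖gradient f x - gradient f y‖ ≤ L * ‖x - y‖)
    (hconv : ConvexOn ℝ Set.univ (fun x => h x - μ / 2 * ‖x‖ ^ 2))
    (H : EuclideanSpace ℝ (Fin N) → ℝ) (hH : H = fun z => f z + h z)
    (zk yk xt x1 : EuclideanSpace ℝ (Fin N))
    (hx1 : x1 = τ₁ • zk + τ₂ • xt + (1 - τ₁ - τ₂) • yk)
    (gt z1 y1 : EuclideanSpace ℝ (Fin N))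
    (hz1 : ∀ z : EuclideanSpace ℝ (Fin N),
      ⟪gt, z1⟫ + 1 / (2 * α) * ‖z1 - zk‖ ^ 2 + h z1
        ≤ ⟪gt, z⟫ + 1 / (2 * α) * ‖z - zk‖ ^ 2 + h z)
    (hy1 : ∀ y : EuclideanSpace ℝ (Fin N),
      ⟪gt, y1⟫ + 3 * L / 2 * ‖y1 - x1‖ ^ 2 + h y1
        ≤ ⟪gt, y⟫ + 3 * L / 2 * ‖y - x1‖ ^ 2 + h y) :
    ∀ u : EuclideanSpace ℝ (Fin N), ∀ β : ℝ, 0 < β →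
      α * ⟪gradient f x1, zk - u⟫ - α * h u
        ≤ α / τ₁ * (f x1 - H y1)
          + α * (1 / (4 * τ₁ * L) + β / 2) * ‖gt - gradient f x1‖ ^ 2
          + (1 + α / β) / 2 * ‖zk - u‖ ^ 2
          - (1 + α * μ) / 2 * ‖z1 - u‖ ^ 2
          + α * τ₂ / τ₁ * h xt + α * (1 - τ₁ - τ₂) / τ₁ * h yk := by
  intro u β hβ
  subst hH
  have hstrong : StrongConvexOn Set.univ μ h := strongConvexOn_iff_convex.2 hconv
  have hh : ConvexOn ℝ Set.univ h := strongConvexOn_zero.1 (hstrong.mono hμ.le)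
  have hyoung := inner_le_mul_sq_add_sq_div hβ (gt - gradient f x1) (u - zk)
  have hprox : ⟪gt, z1⟫ + 1 / α / 2 * ‖z1 - zk‖ ^ 2 + h z1 + (1 / α + μ) / 2 * ‖z1 - u‖ ^ 2
      ≤ ⟪gt, u⟫ + 1 / α / 2 * ‖u - zk‖ ^ 2 + h u := by
    refine (hstrong.inner_add_sq_add gt zk (1 / α)).add_sq_le_of_isMinOn
      (isMinOn_iff.2 fun z _ => ?_) (Set.mem_univ z1) (Set.mem_univ u)
    simpa only [div_div, mul_comm α 2] using hz1 z
  set v := τ₁ • z1 + τ₂ • xt + (1 - τ₁ - τ₂) • yk with hv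
  have hvx : v - x1 = τ₁ • (z1 - zk) := by
    rw [hv, hx1, smul_sub]
    abel
  have hhv : h v ≤ τ₁ * h z1 + τ₂ * h xt + (1 - τ₁ - τ₂) * h yk := by
    have := hh.map_sum_le (t := Finset.univ) (w := ![τ₁, τ₂, 1 - τ₁ - τ₂]) (p := ![z1, xt, yk])
      (by
        intro i _
        fin_cases i
        · exact hτ₁.le
        · exact hτ₂
        · change 0 ≤ 1 - τ₁ - τ₂
          linarith)
      (by simp [Fin.sum_univ_three]) (by simp)
    simpa [Fin.sum_univ_three, hv] using this
  have hyv := hy1 v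
  have hvinner : ⟪gt, v⟫ = ⟪gt, x1⟫ + τ₁ * (⟪gt, z1⟫ - ⟪gt, zk⟫) := by
    rw [← inner_sub_right, ← real_inner_smul_right, ← hvx, inner_sub_right]
    ring
  have hvnorm : ‖v - x1‖ ^ 2 = τ₁ ^ 2 * ‖z1 - zk‖ ^ 2 := by
    rw [hvx, norm_smul, mul_pow, Real.norm_of_nonneg hτ₁.le]
  have hstep : 3 * L / 2 * ‖v - x1‖ ^ 2 ≤ τ₁ / (2 * α) * ‖z1 - zk‖ ^ 2 := by
    rw [hvnorm, ← mul_assoc]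
    refine mul_le_mul_of_nonneg_right ?_ (sq_nonneg _)
    rw [le_div_iff₀ (by positivity)] at hτ₁' ⊢
    nlinarith
  have hdescent := le_add_inner_gradient_add_sq hf hsmooth x1 y1
  have hyoung' := inner_le_mul_sq_add_sq_div (c := 1 / (2 * L)) (by positivity)
    (gt - gradient f x1) (x1 - y1)
  have hL' : 1 / (2 * (1 / (2 * L))) = L := by field_simp
  have hL'' : 1 / (2 * L) / 2 = 1 / (4 * L) := by field_simp; norm_num
  rw [hL', hL'', norm_sub_rev x1 y1] at hyoung'
  rw [norm_sub_rev u zk] at hyoung hprox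
  simp only [inner_sub_left, inner_sub_right] at hyoung hyoung' hdescent ⊢
  have hcoupled : τ₁ * (⟪gt, zk⟫ - ⟪gt, z1⟫) - τ₁ / (2 * α) * ‖z1 - zk‖ ^ 2 - τ₁ * h z1
      ≤ f x1 - (f y1 + h y1) + 1 / (4 * L) * ‖gt - gradient f x1‖ ^ 2
        + τ₂ * h xt + (1 - τ₁ - τ₂) * h yk := by
    linarith
  have hcoupled' := mul_nonneg (div_pos hα hτ₁).le (sub_nonneg.2 hcoupled)
  have hprox' := mul_nonneg hα.le (sub_nonneg.2 hprox)
  have hyoung'' := mul_nonneg hα.le (sub_nonneg.2 hyoung)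
  refine sub_nonneg.1 ((add_nonneg (add_nonneg hcoupled' hprox') hyoung'').trans_eq ?_)
  field_simp
  ring
end

section
/- Let p ≥ 1 and, for each level i ∈ {1,…,p}, let f_{i,1},…,f_{i,n_i} : ℝ^{N_i} → ℝ^{N_{i+1}} each be B_i-Lipschitz with average f_i = (1/n_i) Σ_j f_{i,j}. Set φ_k = f_k ∘ ⋯ ∘ f_1 and γ_k = Π_{i=1}^{k} B_i. Fix x, x̃ ∈ ℝ^{N_1} and integers a_1,…,a_p ≥ 1. For a tuple of index maps σ = (σ_1,…,σ_p) with σ_k : {1,…,a_k} → {1,…,n_k}, define recursively u_1(σ) = (1/a_1) Σ_t (f_{1,σ_1(t)}(x) − f_{1,σ_1(t)}(x̃)) + φ_1(x̃) and, for k ≥ 2, u_k(σ) = (1/a_k) Σ_t (f_{k,σ_k(t)}(u_{k−1}(σ)) − f_{k,σ_k(t)}(φ_{k−1}(x̃))) + φ_k(x̃). Then for every k ∈ {1,…,p}, the uniform average over all tuples σ of ‖u_k(σ) − φ_k(x)‖² is at most γ_k² (Σ_{i=1}^{k} 1/a_i) ‖x − x̃‖². -/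
/-- The average `f̄_k = (1/n_k) Σ_j f_{k,j}` of the maps at level `k`. -/
noncomputable def levelAvg (N n : ℕ → ℕ)
    (f : (k : ℕ) → Fin (n k) → EuclideanSpace ℝ (Fin (N k)) → EuclideanSpace ℝ (Fin (N (k + 1))))
    (k : ℕ) (y : EuclideanSpace ℝ (Fin (N k))) : EuclideanSpace ℝ (Fin (N (k + 1))) :=
  (n k : ℝ)⁻¹ • ∑ j : Fin (n k), f k j y

/-- The composition `φ_k = f̄_{k-1} ∘ ⋯ ∘ f̄_0` (so `φ_0 = id`). -/
noncomputable def phiComp (N n : ℕ → ℕ)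
    (f : (k : ℕ) → Fin (n k) → EuclideanSpace ℝ (Fin (N k)) → EuclideanSpace ℝ (Fin (N (k + 1))))
    (x : EuclideanSpace ℝ (Fin (N 0))) : (k : ℕ) → EuclideanSpace ℝ (Fin (N k))
  | 0 => x
  | k + 1 => levelAvg N n f k (phiComp N n f x k)

/-- The recursively defined inner-level estimators `u_k` of the multi-level SoCK method
(with `u_0 = x`), for a fixed tuple of index maps `σ`. -/
noncomputable def uEst (N n a : ℕ → ℕ)
    (f : (k : ℕ) → Fin (n k) → EuclideanSpace ℝ (Fin (N k)) → EuclideanSpace ℝ (Fin (N (k + 1))))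
    (σ : (k : ℕ) → Fin (a k) → Fin (n k))
    (x xt : EuclideanSpace ℝ (Fin (N 0))) : (k : ℕ) → EuclideanSpace ℝ (Fin (N k))
  | 0 => x
  | k + 1 =>
      ((a k : ℝ)⁻¹ • ∑ t : Fin (a k),
        (f k (σ k t) (uEst N n a f σ x xt k) - f k (σ k t) (phiComp N n f xt k)))
      + phiComp N n f xt (k + 1)

/-- Resampling one coordinate uniformly does not change a uniform sum over tuples. -/
theorem sum_sum_update {ι : Type*} [Fintype ι] [DecidableEq ι] {β : ι → Type*}
    [∀ i, Fintype (β i)] (k : ι) (F : ((i : ι) → β i) → ℝ) :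
    ∑ σ, ∑ τ : β k, F (Function.update σ k τ) = Fintype.card (β k) * ∑ σ, F σ := by
  have hinv : Function.Involutive
      (fun q : ((i : ι) → β i) × β k => (Function.update q.1 k q.2, q.1 k)) := fun q => by
    simp only [Function.update_idem, Function.update_self, Function.update_eq_self, Prod.mk.eta]
  have hswap : ∑ q : ((i : ι) → β i) × β k, F (Function.update q.1 k q.2)
      = ∑ q : ((i : ι) → β i) × β k, F q.1 :=
    hinv.bijective.sum_comp fun q => F q.1
  simpa only [Fintype.sum_prod_type, Finset.sum_const, Finset.card_univ, nsmul_eq_mul,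
    ← Finset.mul_sum] using hswap

section Sampling

variable {E : Type*} [NormedAddCommGroup E] [InnerProductSpace ℝ E]

/-- Second moment of a shifted centred family. -/
theorem sum_norm_add_sq_of_sum_eq_zero {ι : Type*} [Fintype ι] (e : ι → E)
    (he : ∑ j, e j = 0) (c : E) :
    ∑ j, ‖e j + c‖ ^ 2 = ∑ j, ‖e j‖ ^ 2 + Fintype.card ι * ‖c‖ ^ 2 := by
  have h : ∑ j, inner ℝ (e j) c = 0 := by rw [← sum_inner, he, inner_zero_left]
  simp [norm_add_sq_real, Finset.sum_add_distrib, ← Finset.mul_sum, h]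

/-- Second moment of a shifted sum of independent uniform draws from a centred family. -/
theorem sum_norm_sum_add_sq {n : ℕ} (hn : 0 < n) (e : Fin n → E) (he : ∑ j, e j = 0)
    (a : ℕ) (c : E) :
    ∑ τ : Fin a → Fin n, ‖∑ t, e (τ t) + c‖ ^ 2
      = (n : ℝ) ^ a * (‖c‖ ^ 2 + a * ((n : ℝ)⁻¹ * ∑ j, ‖e j‖ ^ 2)) := by
  have hn' : (n : ℝ) ≠ 0 := by positivity
  induction a generalizing c with
  | zero => simp
  | succ a ih =>
    rw [← (Fin.consEquiv fun _ : Fin (a + 1) => Fin n).sum_comp, Fintype.sum_prod_type]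
    have h : ∀ j : Fin n, ∑ τ : Fin a → Fin n,
        ‖∑ t, e ((Fin.consEquiv fun _ : Fin (a + 1) => Fin n) (j, τ) t) + c‖ ^ 2
        = (n : ℝ) ^ a * (‖e j + c‖ ^ 2 + a * ((n : ℝ)⁻¹ * ∑ j, ‖e j‖ ^ 2)) := by
      intro j
      rw [← ih (e j + c)]
      refine Finset.sum_congr rfl fun τ _ => ?_
      simp only [Fin.consEquiv_apply, Fin.sum_univ_succ, Fin.cons_zero, Fin.cons_succ]
      congr 2
      abel
    rw [Finset.sum_congr rfl fun j _ => h j, ← Finset.mul_sum, Finset.sum_add_distrib,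
      sum_norm_add_sq_of_sum_eq_zero e he]
    simp only [Finset.sum_const, Finset.card_univ, Fintype.card_fin, nsmul_eq_mul]
    push_cast
    field_simp
    ring

/-- Mean-squared error of a shifted sample mean of `a` independent uniform draws. -/
theorem sum_norm_sample_mean_sq_le {n a : ℕ} (hn : 0 < n) (ha : 0 < a) (d : Fin n → E) (c : E)
    {R : ℝ} (hd : ∀ j, ‖d j‖ ^ 2 ≤ R) :
    ∑ τ : Fin a → Fin n,
        ‖(a : ℝ)⁻¹ • ∑ t, d (τ t) - (n : ℝ)⁻¹ • ∑ j, d j + c‖ ^ 2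
      ≤ (n : ℝ) ^ a * (‖c‖ ^ 2 + (a : ℝ)⁻¹ * R) := by
  have hn' : (n : ℝ) ≠ 0 := by positivity
  have ha' : (a : ℝ) ≠ 0 := by positivity
  set m : E := (n : ℝ)⁻¹ • ∑ j, d j with hm
  have he : ∑ j, (d j - m) = 0 := by
    simp [hm, ← Nat.cast_smul_eq_nsmul ℝ, smul_smul, hn']
  have hvar : ∑ j, ‖d j - m‖ ^ 2 ≤ n * R := by
    have h1 := sum_norm_add_sq_of_sum_eq_zero _ he m
    have h2 : ∑ j, ‖d j‖ ^ 2 ≤ n * R := by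
      simpa using Finset.sum_le_card_nsmul Finset.univ (fun j => ‖d j‖ ^ 2) R fun j _ => hd j
    simp only [sub_add_cancel] at h1
    have h3 : 0 ≤ (Fintype.card (Fin n) : ℝ) * ‖m‖ ^ 2 := by positivity
    linarith
  have hterm : ∀ τ : Fin a → Fin n, ‖(a : ℝ)⁻¹ • ∑ t, d (τ t) - m + c‖ ^ 2
      = ((a : ℝ)⁻¹) ^ 2 * ‖∑ t, (d (τ t) - m) + (a : ℝ) • c‖ ^ 2 := by
    intro τ
    have h : (a : ℝ)⁻¹ • ∑ t, d (τ t) - m + c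
        = (a : ℝ)⁻¹ • (∑ t, (d (τ t) - m) + (a : ℝ) • c) := by
      simp [smul_add, smul_sub, ← Nat.cast_smul_eq_nsmul ℝ, smul_smul, ha']
    rw [h, norm_smul, mul_pow, Real.norm_eq_abs, sq_abs]
  rw [Finset.sum_congr rfl fun τ _ => hterm τ, ← Finset.mul_sum,
    sum_norm_sum_add_sq hn (fun j => d j - m) he]
  have hvar' : (n : ℝ)⁻¹ * ∑ j, ‖d j - m‖ ^ 2 ≤ R := by
    rw [inv_mul_le_iff₀ (by positivity)]
    exact hvar
  calc ((a : ℝ)⁻¹) ^ 2 * ((n : ℝ) ^ a *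
        (‖(a : ℝ) • c‖ ^ 2 + a * ((n : ℝ)⁻¹ * ∑ j, ‖d j - m‖ ^ 2)))
      ≤ ((a : ℝ)⁻¹) ^ 2 * ((n : ℝ) ^ a * (‖(a : ℝ) • c‖ ^ 2 + a * R)) := by gcongr
    _ = (n : ℝ) ^ a * (‖c‖ ^ 2 + (a : ℝ)⁻¹ * R) := by
        rw [norm_smul, Real.norm_eq_abs, mul_pow, sq_abs]
        field_simp

/-- The norm of a uniform average is at most a common bound on the norms of its terms. -/
theorem norm_average_le {n : ℕ} (hn : 0 < n) (d : Fin n → E) {R : ℝ} (hd : ∀ j, ‖d j‖ ≤ R) :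
    ‖(n : ℝ)⁻¹ • ∑ j, d j‖ ≤ R := by
  have hn' : (0 : ℝ) < n := by positivity
  rw [norm_smul, norm_inv, Real.norm_natCast, inv_mul_le_iff₀ hn']
  simpa using norm_sum_le_of_le Finset.univ fun j _ => hd j

end Sampling

section Multilevel

variable {N n a : ℕ → ℕ} {B : ℕ → ℝ}
  {f : (k : ℕ) → Fin (n k) → EuclideanSpace ℝ (Fin (N k)) → EuclideanSpace ℝ (Fin (N (k + 1)))}

theorem levelAvg_sub (k : ℕ) (y z : EuclideanSpace ℝ (Fin (N k))) :
    levelAvg N n f k y - levelAvg N n f k z = (n k : ℝ)⁻¹ • ∑ j, (f k j y - f k j z) := by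
  simp [levelAvg, smul_sub]

/-- The estimator at level `k` only depends on the index maps below level `k`. -/
theorem uEst_congr (σ σ' : (k : ℕ) → Fin (a k) → Fin (n k))
    (x xt : EuclideanSpace ℝ (Fin (N 0))) (k : ℕ) (h : ∀ i < k, σ i = σ' i) :
    uEst N n a f σ x xt k = uEst N n a f σ' x xt k := by
  induction k with
  | zero => rfl
  | succ k ih =>
    simp only [uEst, ih fun i hi => h i (by omega), h k (by omega)]

/-- Every realization of the estimator stays within `γ_k ‖x - xt‖` of `φ_k(xt)`. -/
theorem norm_uEst_sub_phiComp_le (ha : ∀ k, 0 < a k) (hB : ∀ i, 0 ≤ B i) {p : ℕ}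
    (hLip : ∀ k < p, ∀ j, ∀ x y : EuclideanSpace ℝ (Fin (N k)),
      ‖f k j x - f k j y‖ ≤ B k * ‖x - y‖)
    (σ : (k : ℕ) → Fin (a k) → Fin (n k)) (x xt : EuclideanSpace ℝ (Fin (N 0)))
    (k : ℕ) (hk : k ≤ p) :
    ‖uEst N n a f σ x xt k - phiComp N n f xt k‖ ≤ (∏ i ∈ Finset.range k, B i) * ‖x - xt‖ := by
  induction k with
  | zero => simp [uEst, phiComp]
  | succ k ih =>
    simp only [uEst, add_sub_cancel_right]
    refine norm_average_le (ha k) _ fun t => (hLip k (by omega) _ _ _).trans ?_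
    rw [Finset.prod_range_succ, mul_comm _ (B k), mul_assoc]
    exact mul_le_mul_of_nonneg_left (ih (by omega)) (hB k)

/-- One-level error recursion, averaging over the index map of that level only. -/
theorem sum_norm_level_step_le {k : ℕ} (hn : 0 < n k) (ha : 0 < a k)
    (hLip : ∀ j, ∀ x y : EuclideanSpace ℝ (Fin (N k)),
      ‖f k j x - f k j y‖ ≤ B k * ‖x - y‖)
    (u w z : EuclideanSpace ℝ (Fin (N k))) :
    ∑ τ : Fin (a k) → Fin (n k),
        ‖((a k : ℝ)⁻¹ • ∑ t, (f k (τ t) u - f k (τ t) w)) + levelAvg N n f k w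
          - levelAvg N n f k z‖ ^ 2
      ≤ (n k : ℝ) ^ a k * (B k ^ 2 * ‖u - z‖ ^ 2
          + (a k : ℝ)⁻¹ * (B k ^ 2 * ‖u - w‖ ^ 2)) := by
  have hd : ∀ j, ‖f k j u - f k j w‖ ^ 2 ≤ B k ^ 2 * ‖u - w‖ ^ 2 := fun j => by
    rw [← mul_pow]
    exact pow_le_pow_left₀ (norm_nonneg _) (hLip j u w) 2
  have hc : ‖levelAvg N n f k u - levelAvg N n f k z‖ ^ 2 ≤ B k ^ 2 * ‖u - z‖ ^ 2 := by
    rw [← mul_pow, levelAvg_sub]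
    exact pow_le_pow_left₀ (norm_nonneg _) (norm_average_le hn _ fun j => hLip j u z) 2
  have h := sum_norm_sample_mean_sq_le hn ha (fun j => f k j u - f k j w)
    (levelAvg N n f k u - levelAvg N n f k z) hd
  rw [← levelAvg_sub] at h
  calc _ = _ := Finset.sum_congr rfl fun τ _ => by congr 2; abel
    _ ≤ _ := h
    _ ≤ _ := by gcongr

end Multilevel

/-- mean-squared-error bound for the multi-level inner estimators,
averaged uniformly over all tuples of index maps. -/
theorem multilevel_estimator_mse_bound
    (p : ℕ) (hp : 1 ≤ p) (N n a : ℕ → ℕ) (B : ℕ → ℝ)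
    (hn : ∀ k, 0 < n k) (ha : ∀ k, 0 < a k) (hB : ∀ i, 0 ≤ B i)
    (f : (k : ℕ) → Fin (n k) → EuclideanSpace ℝ (Fin (N k)) → EuclideanSpace ℝ (Fin (N (k + 1))))
    (hLip : ∀ k < p, ∀ j, ∀ x y : EuclideanSpace ℝ (Fin (N k)),
      ‖f k j x - f k j y‖ ≤ B k * ‖x - y‖)
    (x xt : EuclideanSpace ℝ (Fin (N 0))) :
    ∀ k, 1 ≤ k → k ≤ p →
      (∏ i ∈ Finset.range p, ((n i : ℝ) ^ (a i)))⁻¹ *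
          ∑ σ' : (i : Fin p) → Fin (a i) → Fin (n i),
            ‖uEst N n a f
                (fun i => if h : i < p then σ' ⟨i, h⟩ else fun _ => ⟨0, hn i⟩) x xt k
              - phiComp N n f x k‖ ^ 2
        ≤ (∏ i ∈ Finset.range k, B i) ^ 2 * (∑ i ∈ Finset.range k, (a i : ℝ)⁻¹)
          * ‖x - xt‖ ^ 2 := by
  have hcard : (0 : ℝ) < ∏ i ∈ Finset.range p, ((n i : ℝ) ^ (a i)) :=
    Finset.prod_pos fun i _ => pow_pos (by exact_mod_cast hn i) _
  have hcard_eq : (Fintype.card ((i : Fin p) → Fin (a i) → Fin (n i)) : ℝ)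
      = ∏ i ∈ Finset.range p, ((n i : ℝ) ^ (a i)) := by
    rw [Finset.prod_range]
    simp [Fintype.card_pi]
  set ext : ((i : Fin p) → Fin (a i) → Fin (n i)) → (i : ℕ) → Fin (a i) → Fin (n i) :=
    fun σ i => if h : i < p then σ ⟨i, h⟩ else fun _ => ⟨0, hn i⟩ with hext
  intro k _ hk
  rw [inv_mul_le_iff₀ hcard]
  change ∑ σ, ‖uEst N n a f (ext σ) x xt k - phiComp N n f x k‖ ^ 2 ≤ _
  clear * - ha hB hLip hk hcard_eq hn hext
  induction k with
  | zero => simp [uEst, phiComp]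
  | succ k ih =>
    have hkp : k < p := hk
    have ih := ih hkp.le
    set P := ∏ i ∈ Finset.range p, ((n i : ℝ) ^ (a i))
    have hpos : (0 : ℝ) < (n k : ℝ) ^ a k := pow_pos (by exact_mod_cast hn k) _
    have hupd := sum_sum_update (⟨k, hkp⟩ : Fin p) fun σ =>
      ‖uEst N n a f (ext σ) x xt (k + 1) - phiComp N n f x (k + 1)‖ ^ 2
    have hbound : ∀ σ : (i : Fin p) → Fin (a i) → Fin (n i),
        ∑ τ : Fin (a k) → Fin (n k),
          ‖uEst N n a f (ext (Function.update σ ⟨k, hkp⟩ τ)) x xt (k + 1)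
            - phiComp N n f x (k + 1)‖ ^ 2
        ≤ (n k : ℝ) ^ a k * (B k ^ 2 * ‖uEst N n a f (ext σ) x xt k - phiComp N n f x k‖ ^ 2
          + (a k : ℝ)⁻¹ * (B k ^ 2 * ((∏ i ∈ Finset.range k, B i) * ‖x - xt‖) ^ 2)) := by
      intro σ
      have hstep := sum_norm_level_step_le (hn k) (ha k) (hLip k hkp)
        (uEst N n a f (ext σ) x xt k) (phiComp N n f xt k) (phiComp N n f x k)
      have hdet := norm_uEst_sub_phiComp_le ha hB hLip (ext σ) x xt k hkp.le
      calc _ = _ := Finset.sum_congr rfl fun τ _ => by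
            have hlow : uEst N n a f (ext (Function.update σ ⟨k, hkp⟩ τ)) x xt k
                = uEst N n a f (ext σ) x xt k := by
              refine uEst_congr _ _ x xt k fun i hi => ?_
              have hne : (⟨i, hi.trans hkp⟩ : Fin p) ≠ ⟨k, hkp⟩ := by
                simpa [Fin.ext_iff] using hi.ne
              simp [hext, hi.trans hkp, Function.update_of_ne hne]
            have htop : ext (Function.update σ ⟨k, hkp⟩ τ) k = τ := by simp [hext, hkp]
            simp only [uEst, hlow, htop]
            rfl
        _ ≤ _ := hstep
        _ ≤ _ := by gcongr
    have hsum := Finset.sum_le_sum fun σ (_ : σ ∈ Finset.univ) => hbound σ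
    rw [hupd, ← Finset.mul_sum, Finset.sum_add_distrib, ← Finset.mul_sum, Finset.sum_const,
      Finset.card_univ, nsmul_eq_mul, hcard_eq] at hsum
    simp only [Fintype.card_fun, Fintype.card_fin, Nat.cast_pow] at hsum
    refine (le_of_mul_le_mul_left hsum hpos).trans ?_
    refine (add_le_add_left (mul_le_mul_of_nonneg_left ih (sq_nonneg (B k))) _).trans_eq ?_
    rw [Finset.prod_range_succ, Finset.sum_range_succ]
    ring
end
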